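/- Let I be a monomial ideal of S = k[x_1,…,x_n] such that S/I is unmixed, and let r ≥ 2. Then S_r-depth(S^pol/I^pol) = S_r-depth(S/I) + |X_I|, where I^pol ⊆ S^pol = S[X_I] is the polarization of I and |X_I| is the number of new variables introduced by the polarization. -/

import Mathlib

/-!
Common definitions for formalizing "The Serre depth of Stanley–Reisner rings and
the depth of their symbolic powers" (Muta–Terai).
-/

open CategoryTheory MvPolynomial

noncomputable section

namespace SerrePaper

/-! ### Simplicial complexes (given by their sets of faces) -/

variable {V : Type}

/-- A (nonempty, downward closed) abstract simplicial complex, given by its set of faces. -/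
def IsComplex (K : Set (Finset V)) : Prop :=
  K.Nonempty ∧ ∀ F ∈ K, ∀ G ⊆ F, G ∈ K

/-- `F` is a facet (maximal face) of `K`. -/
def IsFacet (K : Set (Finset V)) (F : Finset V) : Prop :=
  F ∈ K ∧ ∀ G ∈ K, F ⊆ G → G = F

/-- `K` is pure: all facets have the same cardinality. -/
def Pure (K : Set (Finset V)) : Prop :=
  ∀ F G : Finset V, IsFacet K F → IsFacet K G → F.card = G.card

/-- `dim K = d - 1`, i.e. the maximal cardinality of a face of `K` is `d`. -/
def HasDimCard (K : Set (Finset V)) (d : ℕ) : Prop :=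
  (∃ F ∈ K, F.card = d) ∧ ∀ F ∈ K, F.card ≤ d

/-- the link of the face `F` in `K`. -/
def link [DecidableEq V] (K : Set (Finset V)) (F : Finset V) : Set (Finset V) :=
  { G | G ∪ F ∈ K ∧ G ∩ F = ∅ }

/-- `skeleton K t` is the `(t-1)`-skeleton `K^{t-1}` of `K`:
all faces with at most `t` vertices. -/
def skeleton (K : Set (Finset V)) (t : ℕ) : Set (Finset V) :=
  { F ∈ K | F.card ≤ t }

/-- The Alexander dual complex `K^∨ = { F | complement of F is not a face of K }`. -/
def dualComplex [Fintype V] [DecidableEq V] (K : Set (Finset V)) : Set (Finset V) :=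
  { F | Fᶜ ∉ K }

/-- The copy of `K` on its own vertex set (as a complex on the corresponding subtype). -/
def restrictVerts (K : Set (Finset V)) : Set (Finset {v : V // {v} ∈ K}) :=
  { F | F.map (Function.Embedding.subtype _) ∈ K }

/-- The induced subcomplex `K_W` on a subset `W` of the vertices. -/
def inducedSub (K : Set (Finset V)) (W : Finset V) : Set (Finset V) :=
  { F ∈ K | F ⊆ W }

/-- `K` is a matroid complex: every induced subcomplex is pure. -/
def IsMatroidComplex (K : Set (Finset V)) : Prop :=
  ∀ W : Finset V, Pure (inducedSub K W)

/-! ### Reduced simplicial homology with coefficients in a field `k` -/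

/-- The group of simplicial `(c-1)`-chains: formal `k`-linear combinations of the
faces of `K` with exactly `c` vertices. -/
abbrev chainGroup (k : Type) [Field k] (K : Set (Finset V)) (c : ℕ) : Type :=
  {F : Finset V // F ∈ K ∧ F.card = c} →₀ k

open Classical in
/-- the boundary of a single face, `∂F = ∑_{x ∈ F} (-1)^{pos of x in F} (F \ {x})`. -/
def boundaryAt (k : Type) [Field k] [LinearOrder V] (K : Set (Finset V)) (c : ℕ)
    (F : {F : Finset V // F ∈ K ∧ F.card = c + 1}) : chainGroup k K c :=
  ∑ x ∈ F.1.attach,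
    if h : F.1.erase x.1 ∈ K then
      Finsupp.single
        ⟨F.1.erase x.1, h, by simp [Finset.card_erase_of_mem x.2, F.2.2]⟩
        ((-1 : k) ^ (F.1.filter (fun y => y < x.1)).card)
    else 0

/-- The simplicial boundary map (for a downward closed `K` this is the usual
boundary map of the reduced (augmented) chain complex of `K`, where faces with
`c` vertices sit in homological degree `c - 1`). -/
def boundary (k : Type) [Field k] [LinearOrder V] (K : Set (Finset V)) (c : ℕ) :
    chainGroup k K (c + 1) →ₗ[k] chainGroup k K c :=
  Finsupp.lsum k fun F => LinearMap.toSpanSingleton k _ (boundaryAt k K c F)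

/-- `H̃ᵢ(K; k) = 0`: every reduced `i`-cycle is a boundary.  (For `i ≤ -2` this holds
trivially; for `i = -1` the relevant cycle group is the whole of the `(-1)`-chains.) -/
def reducedHomologyVanishes (k : Type) [Field k] [LinearOrder V]
    (K : Set (Finset V)) (i : ℤ) : Prop :=
  if i < -1 then True
  else if i = -1 then
    ∀ z : chainGroup k K 0, ∃ b : chainGroup k K 1, boundary k K 0 b = z
  else
    ∀ z : chainGroup k K (i.toNat + 1), boundary k K i.toNat z = 0 →
      ∃ b : chainGroup k K (i.toNat + 2), boundary k K (i.toNat + 1) b = z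

/-- Nonvanishing `β_{i,j}(k[K]) ≠ 0` of the graded Betti numbers of the
Stanley–Reisner ring of `K`, expressed via Hochster's formula:
`β_{i,j}(k[K]) = ∑_{W ⊆ V, |W| = j} dim_k H̃_{j-i-1}(K_W; k)`. -/
def bettiNonzero (k : Type) [Field k] [LinearOrder V] (K : Set (Finset V)) (i j : ℕ) : Prop :=
  ∃ W : Finset V, W.card = j ∧
    ¬ reducedHomologyVanishes k (inducedSub K W) ((j : ℤ) - i - 1)

/-- `reg_{≤ r} I_K = max{ j : β_{i,i+j}(I_K) ≠ 0 for some i ≤ r }`, where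
`β_{i,d}(I_K) = β_{i+1,d}(k[K])`. -/
def regLEIdeal (k : Type) [Field k] [LinearOrder V] (K : Set (Finset V)) (r : ℕ) : ℕ :=
  sSup { j : ℕ | ∃ i ≤ r, bettiNonzero k K (i + 1) (i + j) }

/-- `indeg I_K`: the least degree of a minimal generator of the Stanley–Reisner
ideal of `K`, i.e. `min{ j : β_{0,j}(I_K) = β_{1,j}(k[K]) ≠ 0 }`. -/
def indegIdeal (k : Type) [Field k] [LinearOrder V] (K : Set (Finset V)) : ℕ :=
  sInf { j : ℕ | bettiNonzero k K 1 j }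

/-! ### Stanley–Reisner rings, Serre depth, depth, symbolic powers -/

variable (k : Type) [Field k]

/-- The Stanley–Reisner ideal of `K` (generated by the monomials of the non-faces,
equivalently by those of the minimal non-faces). -/
def srIdeal (K : Set (Finset V)) : Ideal (MvPolynomial V k) :=
  Ideal.span { m | ∃ F : Finset V, F ∉ K ∧ m = ∏ i ∈ F, X i }

/-- The homogeneous maximal ideal `(x_v : v ∈ V)` of the polynomial ring. -/
def maxIdeal (V : Type) : Ideal (MvPolynomial V k) :=
  Ideal.span (Set.range X)

/-- The quotient ring `S/I` as an object of `ModuleCat S`. -/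
def quotMod {V : Type} (I : Ideal (MvPolynomial V k)) : ModuleCat (MvPolynomial V k) :=
  ModuleCat.of _ (MvPolynomial V k ⧸ I)

/-- The Stanley–Reisner ring `k[K] = S/I_K` as a module over `S`. -/
def srRing (K : Set (Finset V)) : ModuleCat (MvPolynomial V k) :=
  quotMod k (srIdeal k K)

/-- The Krull dimension of a module, `dim M = dim (R / ann M)` (so `dim 0 = ⊥ = -∞`). -/
def modDim {R : Type} [CommRing R] (M : ModuleCat R) : WithBot ℕ∞ :=
  ringKrullDim (R ⧸ Module.annihilator R M)

/-- `Ext_R^i(M, N)` as an `R`-module. -/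
def extM {R : Type} [CommRing R] (M N : ModuleCat R) (i : ℕ) : ModuleCat R :=
  ((Ext R (ModuleCat R) i).obj (Opposite.op M)).obj N

/-- `K_M^j = Ext_S^{n-j}(M, ω_S)`, the (Matlis dual of) local cohomology; since the
canonical module `ω_S` of the polynomial ring `S` is `S` itself up to a
grading shift, we use `Ext_S^{n-j}(M, S)`. -/
def serreK {V : Type} (M : ModuleCat (MvPolynomial V k)) (j : ℕ) :
    ModuleCat (MvPolynomial V k) :=
  extM M (ModuleCat.of _ (MvPolynomial V k)) (Nat.card V - j)

/-- The Serre depth `S_r-depth(M) = min{ j : dim K_M^j ≥ j - r + 1 }`.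
(Note that, since `dim K_M^j` is either `⊥` or `≥ 0`, the inequality
`dim K_M^j ≥ j - r + 1` of (possibly negative) integers is equivalent to
`(j + 1 - r : ℕ) ≤ dim K_M^j` with truncated subtraction.) -/
def serreDepth {V : Type} (r : ℕ) (M : ModuleCat (MvPolynomial V k)) : ℕ :=
  sInf { j : ℕ | ((j + 1 - r : ℕ) : WithBot ℕ∞) ≤ modDim (serreK k M j) }

/-- Serre's condition `(S_r)` for an unmixed module: `S_r-depth(M) = dim M`. -/
def serreCond {V : Type} (r : ℕ) (M : ModuleCat (MvPolynomial V k)) : Prop :=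
  (serreDepth k r M : WithBot ℕ∞) = modDim M

/-- The depth of `M` with respect to the homogeneous maximal ideal,
via Rees' characterization `depth M = min{ i : Ext^i(S/m, M) ≠ 0 }`. -/
def mdepth {V : Type} (M : ModuleCat (MvPolynomial V k)) : ℕ :=
  sInf { i : ℕ | Nontrivial (extM (quotMod k (maxIdeal k V)) M i) }

/-- `M` is Cohen–Macaulay: `depth M = dim M`. -/
def isCM {V : Type} (M : ModuleCat (MvPolynomial V k)) : Prop :=
  (mdepth k M : WithBot ℕ∞) = modDim M

/-- The `ℓ`-th symbolic power of a (radical, e.g. squarefree monomial) ideal: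
`I^(ℓ) = ⋂_{P ∈ Min(I)} P^ℓ`. -/
def symbPow {R : Type} [CommRing R] (I : Ideal R) (ℓ : ℕ) : Ideal R :=
  sInf { J | ∃ P ∈ I.minimalPrimes, J = P ^ ℓ }

/-- The height of an ideal: the Krull dimension of the poset of primes contained in it. -/
def idealHeight {R : Type} [CommRing R] (p : Ideal R) : WithBot ℕ∞ :=
  Order.krullDim { q : PrimeSpectrum R // q.asIdeal ≤ p }

/-- `R/I` is unmixed: all associated primes of `R/I` have the same height. -/
def IsUnmixedIdeal {R : Type} [CommRing R] (I : Ideal R) : Prop :=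
  ∀ p q : Ideal R, p ∈ associatedPrimes R (R ⧸ I) → q ∈ associatedPrimes R (R ⧸ I) →
    idealHeight p = idealHeight q

/-- Nonvanishing of the first local cohomology `H_m^1(S/I) ≠ 0`. -/
def H1NE {V : Type} (I : Ideal (MvPolynomial V k)) : Prop :=
  Nontrivial ((localCohomology (maxIdeal k V) 1).obj (quotMod k I))

/-- `I` is a squarefree monomial ideal. -/
def IsSqFreeMonomialIdeal {V : Type} (I : Ideal (MvPolynomial V k)) : Prop :=
  ∃ G : Set (Finset V), I = Ideal.span ((fun F => ∏ i ∈ F, X i) '' G)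

end SerrePaper

end
namespace SerrePaper

noncomputable section

/-- `I` is a monomial ideal. -/
def IsMonomialIdeal (k : Type) [Field k] {V : Type} (I : Ideal (MvPolynomial V k)) : Prop :=
  ∃ A : Set (V →₀ ℕ), I = Ideal.span ((fun a => monomial a (1 : k)) '' A)

/-- The exponent vectors of the minimal monomial generators of a monomial ideal. -/
def minimalExps (k : Type) [Field k] {V : Type} (I : Ideal (MvPolynomial V k)) :
    Set (V →₀ ℕ) :=
  { a | monomial a (1 : k) ∈ I ∧
    ∀ b : V →₀ ℕ, monomial b (1 : k) ∈ I → b ≤ a → b = a }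

/-- `γ_i`: the maximal exponent of `x_i` in a minimal generator of `I`. -/
def polGamma (k : Type) [Field k] {V : Type} (I : Ideal (MvPolynomial V k)) (i : V) : ℕ :=
  sSup { c | ∃ a ∈ minimalExps k I, a i = c }

/-- The ambient variable set of the polarization `S^pol = S[X_I]`: variable `x_i` gives
rise to `max(γ_i, 1)` variables (the original one together with the `γ_i - 1` new
variables of `X_I`). -/
abbrev polVars (k : Type) [Field k] {V : Type} (I : Ideal (MvPolynomial V k)) : Type :=
  Σ i : V, Fin (max (polGamma k I i) 1)

/-- The polarization `I^pol` of a monomial ideal `I`: each minimal generator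
`∏ x_i^{a i}` is replaced by the squarefree monomial `∏_i ∏_{j < a i} x_{i,j}` in the
ring `S^pol` (this is the polarization up to the evident renaming of the variables). -/
def polIdeal (k : Type) [Field k] {V : Type} [Fintype V] [DecidableEq V]
    (I : Ideal (MvPolynomial V k)) :
    Ideal (MvPolynomial (polVars k I) k) :=
  Ideal.span { m | ∃ a ∈ minimalExps k I,
    m = ∏ p : polVars k I, if (p.2 : ℕ) < a p.1 then X p else 1 }

section ListComplex

variable {G : Type}

/-- The boundary of a list in the augmented chain complex of the full simplex on `G`, whose
`p`-chains have the lists of length `p` as a basis. -/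
def listBdry (k : Type) [Field k] : List G → List G →₀ k
  | [] => 0
  | g :: f => Finsupp.single f 1 - (listBdry k f).mapDomain (List.cons g)

/-- The simplicial coboundary of a function on lists. -/
def listCobdry {k : Type} [Field k] (c : List G → k) (f : List G) : k :=
  Finsupp.linearCombination k c (listBdry k f)

variable {k : Type} [Field k]

lemma mem_support_listBdry {f l : List G} (h : l ∈ (listBdry k f).support) :
    l.length + 1 = f.length ∧ l ⊆ f := by
  classical
  induction f generalizing l with
  | nil => simp [listBdry] at h
  | cons g f ih =>
    rw [listBdry] at h
    rcases Finset.mem_union.1 (Finsupp.support_sub h) with h | h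
    · obtain rfl : l = f := by simpa using Finsupp.support_single_subset h
      simp
    · obtain ⟨l', hl', rfl⟩ := Finset.mem_image.1 (Finsupp.mapDomain_support h)
      obtain ⟨h1, h2⟩ := ih hl'
      exact ⟨by simp [h1], List.cons_subset_cons _ h2⟩

lemma linearCombination_mapDomain_cons {M : Type} [AddCommGroup M] [Module k M]
    (v : List G → M) (g : G) (z : List G →₀ k) :
    Finsupp.linearCombination k v (z.mapDomain (List.cons g)) =
      Finsupp.linearCombination k (fun l => v (g :: l)) z :=
  Finsupp.linearCombination_mapDomain k _ z

lemma linearCombination_single_sub (g : G) (z : List G →₀ k) :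
    Finsupp.linearCombination k (fun l => listBdry k (g :: l)) z =
      z - (Finsupp.linearCombination k (listBdry k) z).mapDomain (List.cons g) := by
  induction z using Finsupp.induction_linear with
  | zero => simp
  | add a b ha hb => simp only [map_add, ha, hb, Finsupp.mapDomain_add]; abel
  | single l a =>
    simp [listBdry, smul_sub, Finsupp.mapDomain_smul]

lemma listBdry_listBdry (f : List G) :
    Finsupp.linearCombination k (listBdry k) (listBdry k f) = 0 := by
  induction f with
  | nil => simp [listBdry]
  | cons g f ih =>
    rw [listBdry, map_sub, linearCombination_mapDomain_cons, linearCombination_single_sub, ih]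
    simp

@[simp] lemma listCobdry_nil (c : List G → k) : listCobdry c [] = 0 := by
  simp [listCobdry, listBdry]

lemma listCobdry_cons (c : List G → k) (g : G) (f : List G) :
    listCobdry c (g :: f) = c f - listCobdry (fun l => c (g :: l)) f := by
  simp [listCobdry, listBdry]
  rfl

lemma listCobdry_eq_sum (c : List G → k) (f : List G) :
    listCobdry c f = ∑ l ∈ (listBdry k f).support, listBdry k f l * c l := rfl

lemma listCobdry_congr {c c' : List G → k} {f : List G}
    (h : ∀ l, l.length + 1 = f.length → l ⊆ f → c l = c' l) : listCobdry c f = listCobdry c' f := by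
  rw [listCobdry_eq_sum, listCobdry_eq_sum]
  exact Finset.sum_congr rfl fun l hl => by
    rw [h l (mem_support_listBdry hl).1 (mem_support_listBdry hl).2]

lemma listCobdry_sub (c c' : List G → k) (f : List G) :
    listCobdry (c - c') f = listCobdry c f - listCobdry c' f := by
  simp [listCobdry_eq_sum, mul_sub]

lemma listCobdry_smul (a : k) (c : List G → k) (f : List G) :
    listCobdry (a • c) f = a * listCobdry c f := by
  simp [listCobdry_eq_sum, Finset.mul_sum, mul_left_comm]

lemma listCobdry_listCobdry (c : List G → k) (f : List G) : listCobdry (listCobdry c) f = 0 := by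
  have : ∀ z : List G →₀ k, Finsupp.linearCombination k (listCobdry c) z =
      Finsupp.linearCombination k c (Finsupp.linearCombination k (listBdry k) z) := by
    intro z
    induction z using Finsupp.induction_linear with
    | zero => simp
    | add a b ha hb => simp only [map_add, ha, hb]
    | single l a => simp [listCobdry]
  rw [listCobdry, this, listBdry_listBdry, map_zero]

end ListComplex

section Taylor

variable {σ G : Type}

/-- The exponent of the least common multiple of the monomials `x ^ e g`, `g ∈ f`. -/
def lcmExp (e : G → σ →₀ ℕ) : List G → σ →₀ ℕ
  | [] => 0
  | g :: f => e g ⊔ lcmExp e f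

variable {e : G → σ →₀ ℕ}

lemma lcmExp_le_iff {f : List G} {a : σ →₀ ℕ} : lcmExp e f ≤ a ↔ ∀ g ∈ f, e g ≤ a := by
  induction f with
  | nil => simp [lcmExp]
  | cons g f ih => simp [lcmExp, ih]

lemma lcmExp_mono {f l : List G} (h : l ⊆ f) : lcmExp e l ≤ lcmExp e f :=
  lcmExp_le_iff.2 fun _ hg => lcmExp_le_iff.1 le_rfl _ (h hg)

lemma lt_lcmExp_iff {f : List G} {i : σ} {t : ℕ} :
    t < lcmExp e f i ↔ ∃ g ∈ f, t < e g i := by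
  induction f with
  | nil => simp [lcmExp]
  | cons g f ih => simp [lcmExp, ih]

variable (k : Type) [Field k] (e)

/-- The sum of all terms of the Taylor complex (on ordered tuples of generators). -/
abbrev TaylorTotal (σ G k : Type) [Field k] : Type := List G →₀ MvPolynomial σ k

/-- The differential of the Taylor complex. -/
def taylorBdry : TaylorTotal σ G k →ₗ[MvPolynomial σ k] TaylorTotal σ G k :=
  Finsupp.linearCombination (MvPolynomial σ k) fun f =>
    ∑ l ∈ (listBdry k f).support,
      Finsupp.single l (monomial (lcmExp e f - lcmExp e l) (listBdry k f l))

/-- The chain of multidegree `a` of the Taylor complex given by a chain with coefficients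
in the field. -/
def taylorHom (a : σ →₀ ℕ) : (List G →₀ k) →ₗ[k] TaylorTotal σ G k :=
  Finsupp.lsum k fun l => (Finsupp.lsingle l) ∘ₗ (monomial (a - lcmExp e l))

variable {k e}

lemma taylorHom_single (a : σ →₀ ℕ) (l : List G) (c : k) :
    taylorHom e k a (Finsupp.single l c) = Finsupp.single l (monomial (a - lcmExp e l) c) := by
  simp [taylorHom]

lemma taylorHom_eq_sum (a : σ →₀ ℕ) (z : List G →₀ k) :
    taylorHom e k a z =
      ∑ l ∈ z.support, Finsupp.single l (monomial (a - lcmExp e l) (z l)) := rfl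

lemma taylorBdry_single (f : List G) (s : MvPolynomial σ k) :
    taylorBdry e k (Finsupp.single f s) = s • taylorHom e k (lcmExp e f) (listBdry k f) := by
  simp [taylorBdry, taylorHom_eq_sum]

lemma monomial_smul_taylorHom {a b : σ →₀ ℕ} (c : k) (z : List G →₀ k)
    (h : ∀ l ∈ z.support, lcmExp e l ≤ a) :
    monomial b c • taylorHom e k a z = taylorHom e k (a + b) (c • z) := by
  rw [map_smul, taylorHom_eq_sum, taylorHom_eq_sum, Finset.smul_sum, Finset.smul_sum]
  refine Finset.sum_congr rfl fun l hl => ?_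
  have : b + (a - lcmExp e l) = a + b - lcmExp e l := by
    rw [add_comm, tsub_add_eq_add_tsub (h l hl)]
  simp [Finsupp.smul_single, monomial_mul, this, smul_monomial]

lemma taylorBdry_taylorHom (a : σ →₀ ℕ) (z : List G →₀ k)
    (h : ∀ l ∈ z.support, lcmExp e l ≤ a) :
    taylorBdry e k (taylorHom e k a z) =
      taylorHom e k a (Finsupp.linearCombination k (listBdry k) z) := by
  rw [taylorHom_eq_sum, map_sum, Finsupp.linearCombination_apply, Finsupp.sum, map_sum]
  refine Finset.sum_congr rfl fun l hl => ?_
  rw [taylorBdry_single, monomial_smul_taylorHom, add_tsub_cancel_of_le (h l hl)]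
  exact fun l' hl' => lcmExp_mono (mem_support_listBdry hl').2

lemma support_listBdry_lcmExp_le {a : σ →₀ ℕ} {f : List G} (hf : lcmExp e f ≤ a) :
    ∀ l ∈ (listBdry k f).support, lcmExp e l ≤ a := fun _ hl =>
  (lcmExp_mono (mem_support_listBdry hl).2).trans hf

lemma taylorTotal_induction {p : TaylorTotal σ G k → Prop} (z : TaylorTotal σ G k)
    (h0 : p 0) (hadd : ∀ x y, p x → p y → p (x + y))
    (hs : ∀ a f c, lcmExp e f ≤ a → p (taylorHom e k a (Finsupp.single f c))) : p z := by
  induction z using Finsupp.induction_linear with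
  | zero => exact h0
  | add x y hx hy => exact hadd x y hx hy
  | single f s =>
    induction s using MvPolynomial.induction_on' with
    | monomial u c =>
      have := hs (u + lcmExp e f) f c le_add_self
      rwa [taylorHom_single, add_tsub_cancel_right] at this
    | add p q hp hq =>
      rw [Finsupp.single_add]
      exact hadd _ _ hp hq

lemma taylorBdry_taylorBdry (z : TaylorTotal σ G k) :
    taylorBdry e k (taylorBdry e k z) = 0 := by
  induction z using taylorTotal_induction (e := e) with
  | h0 => simp
  | hadd x y hx hy => simp [hx, hy]
  | hs a f c hf =>
    rw [taylorBdry_taylorHom, taylorBdry_taylorHom]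
    · simp [listBdry_listBdry]
    · simp only [Finsupp.linearCombination_single]
      intro l hl
      exact support_listBdry_lcmExp_le hf l (Finsupp.support_smul hl)
    · intro l hl
      rw [show l = f by simpa using Finsupp.support_single_subset hl]
      exact hf

open Classical in
/-- Prepend to a list a generator dividing the monomial with exponent `a`, if there is one. -/
def consDivisor (e : G → σ →₀ ℕ) (k : Type) [Field k] (a : σ →₀ ℕ) (l : List G) : List G →₀ k :=
  if h : ∃ g, e g ≤ a then Finsupp.single (h.choose :: l) 1 else 0

/-- The contracting homotopy of the Taylor complex: prepend a generator dividing the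
multidegree. -/
def taylorHomotopy (e : G → σ →₀ ℕ) (k : Type) [Field k] :
    TaylorTotal σ G k →ₗ[k] TaylorTotal σ G k :=
  Finsupp.lsum k fun l => (basisMonomials σ k).constr k fun d =>
    taylorHom e k (d + lcmExp e l) (consDivisor e k (d + lcmExp e l) l)

lemma taylorHomotopy_taylorHom {a : σ →₀ ℕ} (z : List G →₀ k)
    (hz : ∀ l ∈ z.support, lcmExp e l ≤ a) :
    taylorHomotopy e k (taylorHom e k a z) =
      taylorHom e k a (Finsupp.linearCombination k (consDivisor e k a) z) := by
  rw [Finsupp.linearCombination_apply, Finsupp.sum, map_sum, taylorHom_eq_sum, map_sum]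
  refine Finset.sum_congr rfl fun l hl => ?_
  have h1 : monomial (a - lcmExp e l) (z l) = z l • basisMonomials σ k (a - lcmExp e l) := by
    simp [smul_monomial]
  rw [taylorHomotopy, Finsupp.lsum_single, h1, map_smul, Module.Basis.constr_basis,
    tsub_add_cancel_of_le (hz l hl), map_smul]

lemma taylorHomotopy_add (z : TaylorTotal σ G k) : ∃ s,
    taylorBdry e k (taylorHomotopy e k z) + taylorHomotopy e k (taylorBdry e k z) =
      z + Finsupp.single [] s := by
  induction z using taylorTotal_induction (e := e) with
  | h0 => exact ⟨0, by simp⟩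
  | hadd x y hx hy =>
    obtain ⟨s, hs⟩ := hx
    obtain ⟨t, ht⟩ := hy
    refine ⟨s + t, ?_⟩
    rw [map_add, map_add, map_add, map_add, Finsupp.single_add, add_add_add_comm, hs, ht]
    abel
  | hs a f c hf =>
    have hf' : ∀ l ∈ (Finsupp.single f c).support, lcmExp e l ≤ a := by
      intro l hl
      rw [show l = f by simpa using Finsupp.support_single_subset hl]
      exact hf
    have hb : ∀ l ∈ (c • listBdry k f).support, lcmExp e l ≤ a := fun l hl =>
      support_listBdry_lcmExp_le hf l (Finsupp.support_smul hl)
    by_cases h : ∃ g, e g ≤ a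
    · refine ⟨0, ?_⟩
      have hc : consDivisor e k a = fun l => Finsupp.single (h.choose :: l) 1 := by
        ext1 l
        simp [consDivisor, h]
      have hg : lcmExp e (h.choose :: f) ≤ a := sup_le h.choose_spec hf
      rw [taylorHomotopy_taylorHom _ hf', taylorBdry_taylorHom _ _ hf',
        Finsupp.linearCombination_single, Finsupp.linearCombination_single,
        taylorHomotopy_taylorHom _ hb, hc, taylorBdry_taylorHom]
      · rw [← map_add, Finsupp.single_zero, add_zero]
        congr 1
        simp only [Finsupp.smul_single, smul_eq_mul, mul_one, Finsupp.linearCombination_single,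
          listBdry, map_smul, smul_sub]
        have : (Finsupp.linearCombination k fun l => Finsupp.single (h.choose :: l) (1 : k))
            (listBdry k f) = (listBdry k f).mapDomain (List.cons h.choose) := by
          simp [Finsupp.linearCombination_apply, Finsupp.mapDomain]
        rw [this]
        abel
      · intro l hl
        rw [Finsupp.smul_single] at hl
        rw [show l = h.choose :: f by simpa using Finsupp.support_single_subset hl]
        exact hg
    · have hc : consDivisor e k a = fun l => 0 := by
        ext1 l
        simp [consDivisor, h]
      obtain rfl : f = [] := by
        rcases f with _ | ⟨g, f⟩
        · rfl
        · exact absurd ⟨g, le_sup_left.trans hf⟩ h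
      rw [taylorHomotopy_taylorHom _ hf', taylorBdry_taylorHom _ _ hf', hc]
      refine ⟨- monomial (a - lcmExp e []) c, ?_⟩
      simp [listBdry, taylorHom_single]

/-- The `p`-th term of the Taylor complex, as a submodule of the sum of all terms. -/
abbrev taylorDeg (σ G k : Type) [Field k] (p : ℕ) :
    Submodule (MvPolynomial σ k) (TaylorTotal σ G k) :=
  Finsupp.supported _ _ {l | l.length = p}

lemma taylorHom_mem {a : σ →₀ ℕ} {z : List G →₀ k} {p : ℕ} (h : ∀ l ∈ z.support, l.length = p) :
    taylorHom e k a z ∈ taylorDeg σ G k p := by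
  rw [taylorHom_eq_sum]
  exact Submodule.sum_mem _ fun l hl => Finsupp.single_mem_supported _ _ (h l hl)

lemma taylorBdry_mem {p : ℕ} {z : TaylorTotal σ G k} (hz : z ∈ taylorDeg σ G k (p + 1)) :
    taylorBdry e k z ∈ taylorDeg σ G k p := by
  rw [← Finsupp.sum_single z, Finsupp.sum, map_sum]
  refine Submodule.sum_mem _ fun f hf => ?_
  rw [taylorBdry_single]
  refine Submodule.smul_mem _ _ (taylorHom_mem fun l hl => ?_)
  have h1 := (mem_support_listBdry hl).1
  have h2 : f.length = p + 1 := hz hf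
  lia

lemma taylorHomotopy_mem {p : ℕ} {z : TaylorTotal σ G k} (hz : z ∈ taylorDeg σ G k p) :
    taylorHomotopy e k z ∈ taylorDeg σ G k (p + 1) := by
  rw [← Finsupp.sum_single z, Finsupp.sum, map_sum]
  refine Submodule.sum_mem _ fun f hf => ?_
  rw [taylorHomotopy, Finsupp.lsum_single, Module.Basis.constr_apply, Finsupp.sum]
  refine Submodule.sum_mem _ fun d _ =>
    Submodule.smul_of_tower_mem _ _ (taylorHom_mem fun l hl => ?_)
  rw [consDivisor] at hl
  split_ifs at hl with h
  · rw [Finset.mem_singleton.1 (Finsupp.support_single_subset hl), List.length_cons, hz hf]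
  · simp at hl

lemma exists_taylorBdry_eq {p : ℕ} {z : TaylorTotal σ G k} (hz : z ∈ taylorDeg σ G k (p + 1))
    (h : taylorBdry e k z = 0) : ∃ w ∈ taylorDeg σ G k (p + 2), taylorBdry e k w = z := by
  have hw := taylorHomotopy_mem (e := e) hz
  refine ⟨_, hw, ?_⟩
  obtain ⟨s, hs⟩ := taylorHomotopy_add (e := e) z
  rw [h, map_zero, add_zero] at hs
  have h0 : ∀ y ∈ taylorDeg σ G k (p + 1), y [] = 0 := fun y hy => by
    by_contra hne
    have : ([] : List G).length = p + 1 := hy (Finsupp.mem_support_iff.2 hne)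
    simp at this
  have h1 := h0 _ (taylorBdry_mem (e := e) hw)
  rw [hs, Finsupp.add_apply, h0 z hz, zero_add, Finsupp.single_eq_same] at h1
  rw [hs, h1, Finsupp.single_zero, add_zero]

/-- The monomial ideal generated by the monomials `x ^ e g`. -/
def expIdeal (e : G → σ →₀ ℕ) (k : Type) [Field k] : Ideal (MvPolynomial σ k) :=
  Ideal.span (Set.range fun g => monomial (e g) 1)

lemma taylorBdry_nil_mem {z : TaylorTotal σ G k} (hz : z ∈ taylorDeg σ G k 1) :
    taylorBdry e k z [] ∈ expIdeal e k := by
  rw [← Finsupp.sum_single z, Finsupp.sum, map_sum, Finsupp.finsetSum_apply]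
  refine Ideal.sum_mem _ fun f hf => ?_
  obtain ⟨g, rfl⟩ := List.length_eq_one_iff.1 (hz hf)
  rw [taylorBdry_single]
  refine Ideal.mul_mem_left _ _ ?_
  simp only [listBdry, Finsupp.mapDomain_zero, sub_zero, taylorHom_single, lcmExp,
    Finsupp.single_eq_same]
  refine Ideal.subset_span ⟨g, ?_⟩
  simp

lemma exists_taylorBdry_eq_single {s : MvPolynomial σ k} (hs : s ∈ expIdeal e k) :
    ∃ w ∈ taylorDeg σ G k 1, taylorBdry e k w = Finsupp.single [] s := by
  have : expIdeal e k ≤ (((taylorDeg σ G k 1).map (taylorBdry e k)).comap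
      (Finsupp.lsingle [])) := by
    refine Ideal.span_le.2 ?_
    rintro _ ⟨g, rfl⟩
    refine ⟨Finsupp.single [g] 1, Finsupp.single_mem_supported _ _ (by simp), ?_⟩
    simp [taylorBdry_single, listBdry, taylorHom_single, lcmExp]
  exact this hs

end Taylor

section ExtAnnihilator

variable {R : Type} [CommRing R]

lemma mem_annihilator_homology_iff (T : ShortComplex (ModuleCat R)) (s : R) :
    s ∈ Module.annihilator R T.homology ↔
      ∀ x : T.X₂, T.g x = 0 → ∃ y : T.X₁, s • x = T.f y := by
  rw [T.moduleCatHomologyIso.toLinearEquiv.annihilator_eq, Module.mem_annihilator]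
  constructor
  · intro h x hx
    have h1 := h (Submodule.Quotient.mk ⟨x, LinearMap.mem_ker.2 hx⟩)
    obtain ⟨y, hy⟩ := (Submodule.Quotient.mk_eq_zero _).1 h1
    exact ⟨y, (congrArg Subtype.val hy).symm⟩
  · intro h q
    obtain ⟨x, rfl⟩ := Submodule.Quotient.mk_surjective _ q
    obtain ⟨y, hy⟩ := h x.1 (LinearMap.mem_ker.1 x.2)
    exact (Submodule.Quotient.mk_eq_zero _).2 ⟨y, Subtype.ext hy.symm⟩

lemma mem_annihilator_extM_iff {M : ModuleCat R} (P : ProjectiveResolution M) (Y : ModuleCat R)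
    (p q : ℕ) (hq : (ComplexShape.up ℕ).prev p = q) (s : R) :
    s ∈ Module.annihilator R (extM M Y p) ↔
      ∀ φ : P.complex.X p ⟶ Y, P.complex.d (p + 1) p ≫ φ = 0 →
        ∃ ψ : P.complex.X q ⟶ Y, s • φ = P.complex.d p q ≫ ψ := by
  have e : extM M Y p ≅ ((P.complex.linearYonedaObj R Y).sc' q p (p + 1)).homology :=
    P.isoExt p Y ≪≫ ShortComplex.homologyMapIso
      ((P.complex.linearYonedaObj R Y).isoSc' q p (p + 1) hq (by simp))
  rw [e.toLinearEquiv.annihilator_eq, mem_annihilator_homology_iff]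
  rfl

end ExtAnnihilator

section TaylorResolution

variable {σ G k : Type} [Field k] (e : G → σ →₀ ℕ)

/-- The differential of the Taylor complex from degree `p + 1` to degree `p`. -/
def taylorD (k : Type) [Field k] (p : ℕ) :
    taylorDeg σ G k (p + 1) →ₗ[MvPolynomial σ k] taylorDeg σ G k p :=
  (taylorBdry e k).restrict fun _ hz => taylorBdry_mem hz

/-- The Taylor complex. -/
def taylorComplex (k : Type) [Field k] : ChainComplex (ModuleCat (MvPolynomial σ k)) ℕ :=
  ChainComplex.of (fun p => ModuleCat.of _ (taylorDeg σ G k p))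
    (fun p => ModuleCat.ofHom (taylorD e k p)) fun _ => 
      ModuleCat.hom_ext (LinearMap.ext fun z => Subtype.ext (taylorBdry_taylorBdry z.1))

lemma taylorComplex_d (p : ℕ) :
    (taylorComplex e k).d (p + 1) p = ModuleCat.ofHom (taylorD e k p) :=
  ChainComplex.of_d (fun p => ModuleCat.of _ (taylorDeg σ G k p))
    (fun p => ModuleCat.ofHom (taylorD e k p)) p

/-- The augmentation of the Taylor complex. -/
def taylorAugmentation (k : Type) [Field k] :
    taylorDeg σ G k 0 →ₗ[MvPolynomial σ k] MvPolynomial σ k ⧸ expIdeal e k :=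
  (expIdeal e k).mkQ ∘ₗ Finsupp.lapply [] ∘ₗ (taylorDeg σ G k 0).subtype

lemma taylorComplex_d_comp : (taylorComplex e k).d 1 0 ≫
    (ModuleCat.ofHom (taylorAugmentation e k) : (taylorComplex e k).X 0 ⟶
      quotMod k (expIdeal e k)) = 0 := by
  rw [taylorComplex_d]
  ext z
  exact (Submodule.Quotient.mk_eq_zero _).2 (taylorBdry_nil_mem z.2)

lemma taylorComplex_exactAt (p : ℕ) : (taylorComplex e k).ExactAt (p + 1) := by
  rw [HomologicalComplex.exactAt_iff' _ (p + 2) (p + 1) p (by simp) (by simp),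
    ShortComplex.moduleCat_exact_iff]
  intro z hz
  have hz' : (taylorComplex e k).d (p + 1) p z = 0 := hz
  rw [taylorComplex_d] at hz'
  obtain ⟨w, hw, h⟩ := exists_taylorBdry_eq z.2 (congrArg Subtype.val hz')
  refine ⟨⟨w, hw⟩, ?_⟩
  change (taylorComplex e k).d (p + 2) (p + 1) _ = _
  rw [taylorComplex_d]
  exact Subtype.ext h

instance (p : ℕ) : Projective ((taylorComplex e k).X p) :=
  have : Module.Free (MvPolynomial σ k) (taylorDeg σ G k p) :=
    Module.Free.of_equiv (Finsupp.supportedEquivFinsupp {l : List G | l.length = p}).symm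
  (IsProjective.iff_projective _).1 (inferInstanceAs
    (Module.Projective (MvPolynomial σ k) (taylorDeg σ G k p)))

/-- The map from the Taylor complex to the quotient by the monomial ideal. -/
def taylorπ (k : Type) [Field k] : taylorComplex e k ⟶
    (ChainComplex.single₀ _).obj (quotMod k (expIdeal e k)) :=
  ((taylorComplex e k).toSingle₀Equiv _).symm
    ⟨ModuleCat.ofHom (taylorAugmentation e k), taylorComplex_d_comp e⟩

lemma taylorπ_f_zero : (taylorπ e k).f 0 = ModuleCat.ofHom (taylorAugmentation e k) :=
  ChainComplex.toSingle₀Equiv_symm_apply_f_zero ..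

lemma taylorDeg_zero_ext {z w : TaylorTotal σ G k} (hz : z ∈ taylorDeg σ G k 0)
    (hw : w ∈ taylorDeg σ G k 0) (h : z [] = w []) : z = w := by
  ext1 l
  rcases l with _ | ⟨g, l⟩
  · exact h
  · have h0 : ∀ y ∈ taylorDeg σ G k 0, y (g :: l) = 0 := fun y hy => by
      by_contra hne
      have : (g :: l).length = 0 := hy (Finsupp.mem_support_iff.2 hne)
      simp at this
    rw [h0 z hz, h0 w hw]

lemma taylorπ_quasiIso : QuasiIso (taylorπ e k) where
  quasiIsoAt m := by
    cases m with
    | zero =>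
      rw [ChainComplex.quasiIsoAt₀_iff, ShortComplex.quasiIso_iff_of_zeros' _ rfl rfl rfl]
      constructor
      · rw [ShortComplex.moduleCat_exact_iff]
        intro z hz
        have hz' : (taylorπ e k).f 0 z = 0 := hz
        rw [taylorπ_f_zero] at hz'
        obtain ⟨w, hw, h⟩ := exists_taylorBdry_eq_single
          ((Submodule.Quotient.mk_eq_zero (expIdeal e k)).1 hz')
        refine ⟨⟨w, hw⟩, ?_⟩
        change (taylorComplex e k).d 1 0 _ = _
        rw [taylorComplex_d]
        refine Subtype.ext (h.trans ?_)
        exact taylorDeg_zero_ext (Finsupp.single_mem_supported _ _ rfl) z.2 Finsupp.single_eq_same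
      · rw [ModuleCat.epi_iff_surjective]
        intro q
        obtain ⟨s, rfl⟩ := Ideal.Quotient.mk_surjective q
        refine ⟨⟨Finsupp.single [] s, Finsupp.single_mem_supported _ _ rfl⟩, ?_⟩
        change (taylorπ e k).f 0 _ = _
        rw [taylorπ_f_zero]
        exact congrArg (Ideal.Quotient.mk _) Finsupp.single_eq_same
    | succ m =>
      rw [quasiIsoAt_iff_exactAt' (hL := ChainComplex.exactAt_succ_single_obj ..)]
      exact taylorComplex_exactAt e m

/-- The Taylor resolution of a monomial ideal. -/
def taylorResolution (k : Type) [Field k] : ProjectiveResolution (quotMod k (expIdeal e k)) where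
  complex := taylorComplex e k
  π := taylorπ e k
  quasiIso := taylorπ_quasiIso e

variable {e}

/-- The differential of the dual of the Taylor complex. -/
def taylorCobdry (e : G → σ →₀ ℕ) (c : List G → MvPolynomial σ k) (f : List G) :
    MvPolynomial σ k :=
  ∑ l ∈ (listBdry k f).support, monomial (lcmExp e f - lcmExp e l) (listBdry k f l) * c l

lemma linearCombination_taylorBdry_single (c : List G → MvPolynomial σ k) (f : List G) :
    Finsupp.linearCombination (MvPolynomial σ k) c (taylorBdry e k (Finsupp.single f 1)) =
      taylorCobdry e c f := by
  simp [taylorBdry_single, taylorHom_eq_sum, taylorCobdry]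

lemma taylorDeg_hom_ext {p : ℕ} {φ ψ : TaylorTotal σ G k →ₗ[MvPolynomial σ k] MvPolynomial σ k}
    (h : ∀ l : List G, l.length = p → φ (Finsupp.single l 1) = ψ (Finsupp.single l 1))
    {z : TaylorTotal σ G k} (hz : z ∈ taylorDeg σ G k p) : φ z = ψ z := by
  rw [← Finsupp.sum_single z, Finsupp.sum, map_sum, map_sum]
  refine Finset.sum_congr rfl fun l hl => ?_
  rw [← mul_one (z l), ← smul_eq_mul, ← Finsupp.smul_single, map_smul, map_smul, h l (hz hl)]

variable (σ) in
/-- The linear function on the `p`-th term of the Taylor complex with the given values on the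
basis. -/
def taylorFun (p : ℕ) (c : List G → MvPolynomial σ k) :
    taylorDeg σ G k p →ₗ[MvPolynomial σ k] MvPolynomial σ k :=
  Finsupp.linearCombination (MvPolynomial σ k) c ∘ₗ (taylorDeg σ G k p).subtype

lemma exists_eq_taylorFun {p : ℕ}
    (φ : taylorDeg σ G k p →ₗ[MvPolynomial σ k] MvPolynomial σ k) :
    ∃ c : List G → MvPolynomial σ k, φ = taylorFun σ p c := by
  classical
  refine ⟨fun l => φ (Finsupp.restrictDom _ _ {l | l.length = p} (Finsupp.single l 1)), ?_⟩
  refine LinearMap.ext fun z => ?_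
  have : φ z = φ (Finsupp.restrictDom _ _ {l | l.length = p} z.1) := by
    conv_lhs => rw [← LinearMap.id_apply (R := MvPolynomial σ k) z,
      ← Finsupp.restrictDom_comp_subtype {l : List G | l.length = p}]
    rfl
  rw [this]
  refine taylorDeg_hom_ext (φ := φ ∘ₗ Finsupp.restrictDom _ _ {l : List G | l.length = p})
    (ψ := Finsupp.linearCombination _ _) (fun l _ => ?_) z.2
  simp

lemma taylorFun_eq_iff {p : ℕ} {c c' : List G → MvPolynomial σ k} :
    taylorFun σ p c = taylorFun σ p c' ↔ ∀ l, l.length = p → c l = c' l := by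
  constructor
  · intro h l hl
    have := LinearMap.congr_fun h ⟨Finsupp.single l 1, Finsupp.single_mem_supported _ _ hl⟩
    simpa [taylorFun] using this
  · intro h
    refine LinearMap.ext fun z => ?_
    exact taylorDeg_hom_ext (φ := Finsupp.linearCombination _ c)
      (ψ := Finsupp.linearCombination _ c') (fun l hl => by simp [h l hl]) z.2

lemma taylorFun_comp_taylorD {p : ℕ} (c : List G → MvPolynomial σ k) :
    taylorFun σ p c ∘ₗ taylorD e k p = taylorFun σ (p + 1) (taylorCobdry e c) := by
  refine LinearMap.ext fun z => ?_
  refine taylorDeg_hom_ext (φ := Finsupp.linearCombination _ c ∘ₗ taylorBdry e k)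
    (ψ := Finsupp.linearCombination _ _) (fun l _ => ?_) z.2
  simp [linearCombination_taylorBdry_single]

lemma taylorFun_zero {p : ℕ} : taylorFun σ p (0 : List G → MvPolynomial σ k) = 0 :=
  LinearMap.ext fun z => by simp [taylorFun]

lemma smul_taylorFun {p : ℕ} (s : MvPolynomial σ k) (c : List G → MvPolynomial σ k) :
    s • taylorFun σ p c = taylorFun σ p (fun l => s * c l) := by
  refine LinearMap.ext fun z => ?_
  refine taylorDeg_hom_ext (φ := s • Finsupp.linearCombination _ c)
    (ψ := Finsupp.linearCombination _ _) (fun l _ => ?_) z.2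
  simp

variable (e) in
lemma mem_annihilator_extM_expIdeal_iff (p : ℕ) (s : MvPolynomial σ k) :
    s ∈ Module.annihilator (MvPolynomial σ k)
        (extM (quotMod k (expIdeal e k)) (ModuleCat.of _ (MvPolynomial σ k)) p) ↔
      ∀ c : List G → MvPolynomial σ k, (∀ l, l.length = p + 1 → taylorCobdry e c l = 0) →
        ∃ b : List G → MvPolynomial σ k, ∀ l, l.length = p → s * c l = taylorCobdry e b l := by
  let hom (q : ℕ) (c : List G → MvPolynomial σ k) :
      (taylorComplex e k).X q ⟶ ModuleCat.of _ (MvPolynomial σ k) :=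
    ModuleCat.ofHom (taylorFun σ q c)
  have hsurj (q : ℕ) (φ : (taylorComplex e k).X q ⟶ ModuleCat.of _ (MvPolynomial σ k)) :
      ∃ c, φ = hom q c := by
    obtain ⟨c, hc⟩ := exists_eq_taylorFun φ.hom
    exact ⟨c, ModuleCat.hom_ext hc⟩
  have heq (q : ℕ) (c c' : List G → MvPolynomial σ k) :
      hom q c = hom q c' ↔ ∀ l, l.length = q → c l = c' l := by
    rw [← taylorFun_eq_iff]
    exact ⟨fun h => congrArg ModuleCat.Hom.hom h, fun h => ModuleCat.hom_ext h⟩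
  have hd (q : ℕ) (c : List G → MvPolynomial σ k) :
      (taylorComplex e k).d (q + 1) q ≫ hom q c = hom (q + 1) (taylorCobdry e c) := by
    rw [taylorComplex_d]
    exact ModuleCat.hom_ext (taylorFun_comp_taylorD c)
  have hzero (q : ℕ) : (0 : (taylorComplex e k).X q ⟶ _) = hom q 0 :=
    ModuleCat.hom_ext taylorFun_zero.symm
  have hsmul (q : ℕ) (c : List G → MvPolynomial σ k) :
      s • hom q c = hom q (fun l => s * c l) :=
    ModuleCat.hom_ext (smul_taylorFun s c)
  have key : (∃ q, (ComplexShape.up ℕ).prev p = q ∧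
      ∀ φ : (taylorComplex e k).X q ⟶ _, ∃ b, (taylorComplex e k).d p q ≫ φ =
        hom p (taylorCobdry e b)) := by
    cases p with
    | zero =>
      refine ⟨_, rfl, fun φ => ⟨0, ?_⟩⟩
      rw [(taylorComplex e k).shape, Limits.zero_comp, hzero, heq]
      · simp [taylorCobdry]
      · simp
    | succ p =>
      refine ⟨p, by simp, fun φ => ?_⟩
      obtain ⟨b, rfl⟩ := hsurj _ φ
      exact ⟨b, hd _ _⟩
  obtain ⟨q, hq, key⟩ := key
  refine (mem_annihilator_extM_iff (taylorResolution e k) _ p q hq s).trans ?_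
  constructor
  · intro H c hc
    obtain ⟨ψ, hψ⟩ := H (hom p c) (((hd p c).trans ((heq _ _ _).2 hc)).trans (hzero _).symm)
    obtain ⟨b, hb⟩ := key ψ
    exact ⟨b, (heq _ _ _).1 ((hsmul _ _).symm.trans (hψ.trans hb))⟩
  · intro H φ hφ
    obtain ⟨c, rfl⟩ := hsurj p φ
    obtain ⟨b, hb⟩ := H c ((heq _ _ _).1 (((hd p c).symm.trans hφ).trans (hzero _)))
    rw [← heq, ← hsmul] at hb
    cases p with
    | zero =>
      refine ⟨0, (hb.trans ?_).trans Limits.comp_zero.symm⟩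
      refine ((heq _ _ _).2 fun l hl => ?_).trans (hzero 0).symm
      simp [List.length_eq_zero_iff.1 hl, taylorCobdry, listBdry]
    | succ p =>
      obtain rfl : p = q := by simpa using hq
      exact ⟨hom p b, hb.trans (hd _ _).symm⟩

end TaylorResolution

section Multidegree

variable {σ G k : Type} [Field k] {e : G → σ →₀ ℕ}

open Classical in
/-- The component of degree `w - u` of a cochain of the dual of the Taylor complex. -/
def degComp (e : G → σ →₀ ℕ) (w u : σ →₀ ℕ) (c : List G → MvPolynomial σ k) (l : List G) : k :=
  if u ≤ w + lcmExp e l then coeff (w + lcmExp e l - u) (c l) else 0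

/-- The cochain of the dual of the Taylor complex which is homogeneous of degree `w - u` and
has the given coefficients. -/
def ofDegComp (e : G → σ →₀ ℕ) (w u : σ →₀ ℕ) (c : List G → k) (l : List G) :
    MvPolynomial σ k :=
  monomial (w + lcmExp e l - u) (c l)

lemma taylorCobdry_ofDegComp {w u : σ →₀ ℕ} {c : List G → k} {f : List G}
    (hc : ∀ l, l.length + 1 = f.length → c l ≠ 0 → u ≤ w + lcmExp e l) :
    taylorCobdry e (ofDegComp e w u c) f = ofDegComp e w u (listCobdry c) f := by
  rw [ofDegComp, listCobdry_eq_sum, map_sum]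
  refine Finset.sum_congr rfl fun l hl => ?_
  obtain ⟨h1, h2⟩ := mem_support_listBdry hl
  by_cases h0 : c l = 0
  · simp [ofDegComp, h0]
  · have h3 := hc l h1 h0
    have h4 := lcmExp_mono (e := e) h2
    rw [ofDegComp, monomial_mul]
    congr 2
    ext i
    have := h3 i
    have := h4 i
    simp only [Finsupp.coe_add, Finsupp.coe_tsub, Pi.add_apply, Pi.sub_apply] at *
    lia

lemma degComp_taylorCobdry (w u : σ →₀ ℕ) (c : List G → MvPolynomial σ k) (f : List G) :
    degComp e w u (taylorCobdry e c) f = listCobdry (degComp e w u c) f := by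
  rw [degComp, listCobdry_eq_sum]
  split_ifs with h
  · rw [taylorCobdry, coeff_sum]
    refine Finset.sum_congr rfl fun l hl => ?_
    have h4 := lcmExp_mono (e := e) (mem_support_listBdry hl).2
    have h5 : lcmExp e f - lcmExp e l ≤ w + lcmExp e f - u ↔ u ≤ w + lcmExp e l := by
      refine forall_congr' fun i => ?_
      have := h4 i
      have := h i
      simp only [Finsupp.coe_add, Finsupp.coe_tsub, Pi.add_apply, Pi.sub_apply] at *
      lia
    simp only [coeff_monomial_mul', degComp, h5]
    split_ifs with h6
    · congr 2
      ext i
      have := h4 i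
      have := h i
      have := h6 i
      simp only [Finsupp.coe_add, Finsupp.coe_tsub, Pi.add_apply, Pi.sub_apply] at *
      lia
    · simp
  · refine (Finset.sum_eq_zero fun l hl => ?_).symm
    rw [degComp, if_neg, mul_zero]
    exact fun h' => h (h'.trans (add_le_add_right (lcmExp_mono (mem_support_listBdry hl).2) w))

lemma degComp_mul_ofDegComp {w u : σ →₀ ℕ} {c : List G → k} {l : List G}
    (s : MvPolynomial σ k) (hc : c l ≠ 0 → u ≤ lcmExp e l) :
    degComp e w u (fun l => s * ofDegComp e 0 u c l) l = coeff w s * c l := by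
  rw [degComp, ofDegComp]
  by_cases h0 : c l = 0
  · simp [h0]
  · have h := hc h0
    rw [if_pos (le_add_left h), zero_add, add_tsub_assoc_of_le h, coeff_mul_monomial]

variable [Finite G]

lemma sum_ofDegComp_degComp {W : σ →₀ ℕ} (hW : ∀ g, e g ≤ W) (p : ℕ)
    (c : List G → MvPolynomial σ k) : ∃ T : Finset (σ →₀ ℕ), ∀ f : List G, f.length = p →
      ∑ t ∈ T, ofDegComp e t W (degComp e t W c) f = c f := by
  classical
  refine ⟨(List.finite_length_eq G p).toFinset.biUnion fun f =>
    (c f).support.image fun d => d + (W - lcmExp e f), fun f hf => ?_⟩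
  have hfW : lcmExp e f ≤ W := lcmExp_le_iff.2 fun g _ => hW g
  ext d
  rw [coeff_sum]
  have key : ∀ t, coeff d (ofDegComp e t W (degComp e t W c) f) =
      if t = d + (W - lcmExp e f) then coeff d (c f) else 0 := by
    intro t
    rw [ofDegComp, coeff_monomial, degComp]
    by_cases h : W ≤ t + lcmExp e f
    · have : t + lcmExp e f - W = d ↔ t = d + (W - lcmExp e f) := by
        rw [DFunLike.ext_iff, DFunLike.ext_iff]
        refine forall_congr' fun i => ?_
        have := h i
        have := hfW i
        simp only [Finsupp.coe_add, Finsupp.coe_tsub, Pi.add_apply, Pi.sub_apply] at *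
        lia
      rw [if_pos h]
      simp only [this]
      split_ifs with h1
      · rw [this.2 h1]
      · rfl
    · rw [if_neg h, ite_self, if_neg]
      rintro rfl
      refine h fun i => ?_
      have := hfW i
      simp only [Finsupp.coe_add, Finsupp.coe_tsub, Pi.add_apply, Pi.sub_apply] at *
      lia
  simp only [key, Finset.sum_ite_eq', Finset.mem_biUnion, Finset.mem_image]
  split_ifs with h
  · rfl
  · by_contra h'
    exact h ⟨f, by simpa using hf, d, mem_support_iff.2 (Ne.symm h'), rfl⟩

end Multidegree

section Criterion

/-- There is a simplicial `p`-cocycle with support in `K` which is not the coboundary of a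
cochain with support in `K'`. -/
def CocycleNZ (k : Type) [Field k] {G : Type} (p : ℕ) (K K' : Set (List G)) : Prop :=
  ∃ c : List G → k, (∀ l, l.length = p → c l ≠ 0 → l ∈ K) ∧
    (∀ l, l.length = p + 1 → listCobdry c l = 0) ∧
    ¬ ∃ b : List G → k, (∀ l, l.length + 1 = p → b l ≠ 0 → l ∈ K') ∧
      ∀ l, l.length = p → c l = listCobdry b l

variable {σ G k : Type} [Field k] {e : G → σ →₀ ℕ}

/-- The lists of generators whose least common multiple is divisible by `x ^ u`. -/
def hitSet (e : G → σ →₀ ℕ) (u : σ →₀ ℕ) : Set (List G) := {f | u ≤ lcmExp e f}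

lemma coeff_eq_zero_of_mem_annihilator {p : ℕ} {F : Finset σ} [DecidablePred (· ∉ F)]
    {u : σ →₀ ℕ}
    (h : CocycleNZ k p (hitSet e u) (hitSet e (u.filter (· ∉ F)))) {s : MvPolynomial σ k}
    (hs : s ∈ Module.annihilator (MvPolynomial σ k)
      (extM (quotMod k (expIdeal e k)) (ModuleCat.of _ (MvPolynomial σ k)) p))
    {w : σ →₀ ℕ} (hw : ∀ i, w i ≠ 0 → i ∈ F) : coeff w s = 0 := by
  obtain ⟨c, hcK, hc, hb⟩ := h
  by_contra hne
  obtain ⟨ψ, hψ⟩ := (mem_annihilator_extM_expIdeal_iff e p s).1 hs (ofDegComp e 0 u c)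
    fun l hl => by
      rw [taylorCobdry_ofDegComp]
      · simp [ofDegComp, hc l hl]
      · intro l' hl' h'
        rw [zero_add]
        exact hcK l' (by lia) h'
  refine hb ⟨fun l => (coeff w s)⁻¹ * degComp e w u ψ l, fun l hl h0 i => ?_, fun l hl => ?_⟩
  · have h1 : u ≤ w + lcmExp e l := by
      by_contra h1
      simp [degComp, h1] at h0
    rw [Finsupp.filter_apply]
    split_ifs with hi
    · exact Nat.zero_le _
    · have := h1 i
      rw [Finsupp.add_apply, not_imp_comm.1 (hw i) hi, zero_add] at this
      exact this
  · change c l = listCobdry ((coeff w s)⁻¹ • degComp e w u ψ) l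
    rw [listCobdry_smul, ← degComp_taylorCobdry, ← mul_right_inj' hne, ← mul_assoc,
      mul_inv_cancel₀ hne, one_mul, ← degComp_mul_ofDegComp (e := e) (u := u) s (hcK l hl),
      degComp, degComp, hψ l hl]

lemma monomial_mem_annihilator [Finite G] {W : σ →₀ ℕ} (hW : ∀ g, e g ≤ W) {p : ℕ} {F : Finset σ}
    [DecidablePred (· ∈ F)] [DecidablePred (· ∉ F)]
    (h : ∀ u, ¬ CocycleNZ k p (hitSet e u) (hitSet e (u.filter (· ∉ F)))) :
    monomial (W.filter (· ∈ F)) 1 ∈ Module.annihilator (MvPolynomial σ k)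
      (extM (quotMod k (expIdeal e k)) (ModuleCat.of _ (MvPolynomial σ k)) p) := by
  rw [mem_annihilator_extM_expIdeal_iff]
  intro c hc
  obtain ⟨T, hT⟩ := sum_ofDegComp_degComp hW p c
  have hb : ∀ t : σ →₀ ℕ, ∃ b : List G → k,
      (∀ l, l.length + 1 = p → b l ≠ 0 → l ∈ hitSet e ((W - t).filter (· ∉ F))) ∧
      ∀ l, l.length = p → degComp e t W c l = listCobdry b l := by
    intro t
    by_contra hb
    refine h (W - t) ⟨degComp e t W c, fun l _ h0 => ?_, fun l hl => ?_, hb⟩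
    · have h1 : W ≤ t + lcmExp e l := by
        by_contra h1
        simp [degComp, h1] at h0
      exact tsub_le_iff_left.2 h1
    · rw [← degComp_taylorCobdry, degComp, hc l hl, coeff_zero, ite_self]
  choose b hb hb' using hb
  refine ⟨fun l => ∑ t ∈ T, ofDegComp e (W.filter (· ∈ F) + t) W (b t) l, fun l hl => ?_⟩
  have hsum : taylorCobdry e (fun l => ∑ t ∈ T, ofDegComp e (W.filter (· ∈ F) + t) W (b t) l) l =
      ∑ t ∈ T, taylorCobdry e (ofDegComp e (W.filter (· ∈ F) + t) W (b t)) l := by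
    simp only [taylorCobdry, Finset.mul_sum]
    exact Finset.sum_comm
  rw [hsum, ← hT l hl, Finset.mul_sum]
  refine Finset.sum_congr rfl fun t _ => ?_
  rw [taylorCobdry_ofDegComp]
  · rw [ofDegComp, ofDegComp, monomial_mul, one_mul, hb' t l hl]
    by_cases h0 : listCobdry (b t) l = 0
    · simp [h0]
    · rw [← hb' t l hl] at h0
      have h1 : W ≤ t + lcmExp e l := by
        by_contra h1
        simp [degComp, h1] at h0
      rw [add_assoc, add_tsub_assoc_of_le h1]
  · intro l' hl' h0 i
    have := hb t l' (by lia) h0 i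
    simp only [Finsupp.add_apply, Finsupp.filter_apply, Finsupp.tsub_apply] at this ⊢
    split_ifs at this ⊢ <;> lia

end Criterion

section Dimension

variable {σ G k : Type} [Field k] {e : G → σ →₀ ℕ}

lemma ringKrullDim_mvPolynomial_finset (F : Finset σ) :
    ringKrullDim (MvPolynomial F k) = F.card := by
  rw [MvPolynomial.ringKrullDim_of_isNoetherianRing, ringKrullDim_eq_zero_of_field, zero_add]
  simp

/-- The dimension of a quotient by an ideal which only involves monomials outside of `F`. -/
lemma card_le_ringKrullDim_quotient {F : Finset σ} {J : Ideal (MvPolynomial σ k)}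
    (h : ∀ s ∈ J, ∀ w : σ →₀ ℕ, (∀ i, w i ≠ 0 → i ∈ F) → coeff w s = 0) :
    (F.card : WithBot ℕ∞) ≤ ringKrullDim (MvPolynomial σ k ⧸ J) := by
  rw [← ringKrullDim_mvPolynomial_finset (k := k)]
  have hJ : ∀ s ∈ J, (killCompl (R := k) (Subtype.val_injective (p := (· ∈ F)))) s = 0 := by
    intro s hs
    ext w
    rw [coeff_killCompl, coeff_zero]
    refine h s hs _ fun i hi => ?_
    by_contra hiF
    refine hi (Finsupp.mapDomain_of_notMem_range _ _ ?_)
    simpa using hiF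
  refine ringKrullDim_le_of_surjective (Ideal.Quotient.lift J
    (killCompl (R := k) (Subtype.val_injective (p := (· ∈ F)))).toRingHom hJ) ?_
  refine Ideal.Quotient.lift_surjective_of_surjective _ _ fun s => ⟨rename Subtype.val s, ?_⟩
  exact killCompl_rename_app _ s

lemma ringKrullDim_quotient_le_card {F : Finset σ} {P : Ideal (MvPolynomial σ k)}
    (h : ∀ i ∉ F, X i ∈ P) : ringKrullDim (MvPolynomial σ k ⧸ P) ≤ F.card := by
  rw [← ringKrullDim_mvPolynomial_finset (k := k)]
  refine ringKrullDim_le_of_surjective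
    ((Ideal.Quotient.mkₐ k P).comp (rename (Subtype.val : F → σ))).toRingHom fun q => ?_
  obtain ⟨s, rfl⟩ := Ideal.Quotient.mk_surjective q
  have hr : Ideal.Quotient.mkₐ k P s ∈ ((Ideal.Quotient.mkₐ k P).comp
      (rename (Subtype.val : F → σ))).range := by
    induction s using MvPolynomial.induction_on with
    | C a => exact ⟨C a, by simp⟩
    | add p q hp hq => rw [map_add]; exact add_mem hp hq
    | mul_X p i hp =>
      rw [map_mul]
      refine mul_mem hp ?_
      by_cases hi : i ∈ F
      · exact ⟨X ⟨i, hi⟩, by simp⟩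
      · rw [show Ideal.Quotient.mkₐ k P (X i) = 0 from Ideal.Quotient.eq_zero_iff_mem.2 (h i hi)]
        exact zero_mem _
  exact hr

lemma exists_prime_of_le_ringKrullDim_quotient {R : Type} [CommRing R] (J : Ideal R) {m : ℕ}
    (h : (m : WithBot ℕ∞) ≤ ringKrullDim (R ⧸ J)) :
    ∃ P : Ideal R, P.IsPrime ∧ J ≤ P ∧ (m : WithBot ℕ∞) ≤ ringKrullDim (R ⧸ P) := by
  rw [ringKrullDim_quotient] at h
  obtain ⟨L, rfl⟩ := Order.le_krullDim_iff.1 h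
  refine ⟨L.head.1.asIdeal, L.head.1.isPrime, L.head.2, ?_⟩
  rw [ringKrullDim_quotient]
  refine Order.le_krullDim_iff.2 ⟨⟨L.length, fun i => ⟨(L i).1, ?_⟩, fun i => L.step i⟩, rfl⟩
  exact L.head_le i

theorem le_modDim_extM_iff [Finite σ] [Finite G] [∀ F : Finset σ, DecidablePred (· ∉ F)]
    (e : G → σ →₀ ℕ) (p m : ℕ) :
    (m : WithBot ℕ∞) ≤
        modDim (extM (quotMod k (expIdeal e k)) (ModuleCat.of _ (MvPolynomial σ k)) p) ↔
      ∃ F : Finset σ, m ≤ F.card ∧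
        ∃ u, CocycleNZ k p (hitSet e u) (hitSet e (u.filter (· ∉ F))) := by
  classical
  constructor
  · intro h
    have := Fintype.ofFinite σ
    have := Fintype.ofFinite G
    obtain ⟨P, hP, hJ, hm⟩ := exists_prime_of_le_ringKrullDim_quotient _ h
    refine ⟨Finset.univ.filter fun i => X i ∉ P, ?_, ?_⟩
    · exact_mod_cast hm.trans (ringKrullDim_quotient_le_card (by simp))
    · by_contra! hF
      have h1 := hJ (monomial_mem_annihilator (W := Finset.univ.sup e)
        (fun g => Finset.le_sup (Finset.mem_univ g)) hF)
      rw [monomial_eq, map_one, one_mul, Finsupp.prod, hP.prod_mem_iff] at h1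
      obtain ⟨i, hi, h1⟩ := h1
      rw [Finsupp.support_filter, Finset.mem_filter] at hi
      exact (Finset.mem_filter.1 hi.2).2 (hP.mem_of_pow_mem _ h1)
  · rintro ⟨F, hF, u, h⟩
    refine le_trans ?_ (card_le_ringKrullDim_quotient (F := F) fun s hs w hw =>
      coeff_eq_zero_of_mem_annihilator h hs hw)
    exact_mod_cast hF

end Dimension

section Cocycle

variable {σ G k : Type} [Field k] {e : G → σ →₀ ℕ}

lemma CocycleNZ.mono {p : ℕ} {K L K' : Set (List G)} (h : CocycleNZ k p K K') (hKL : K ⊆ L) :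
    CocycleNZ k p L K' := by
  obtain ⟨c, h1, h2⟩ := h
  exact ⟨c, fun l hl h0 => hKL (h1 l hl h0), h2⟩

lemma CocycleNZ.nonempty {p : ℕ} {K K' : Set (List G)} (h : CocycleNZ k p K K') : K.Nonempty := by
  obtain ⟨c, h1, -, h3⟩ := h
  by_contra hK
  refine h3 ⟨0, by simp, fun l hl => ?_⟩
  rw [listCobdry_eq_sum]
  simpa using not_imp_comm.1 (h1 l hl) fun hl => hK ⟨l, hl⟩

lemma hitSet_anti {u v : σ →₀ ℕ} (h : u ≤ v) : hitSet e v ⊆ hitSet e u := fun _ hf => h.trans hf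

end Cocycle

section Polarization

variable {V G k : Type} [Field k] [Fintype V] {N : V → ℕ}

/-- The exponents of the polarizations of monomials. -/
def polExp (N : V → ℕ) (e : G → V →₀ ℕ) (g : G) : (Σ i, Fin (N i)) →₀ ℕ :=
  Finsupp.equivFunOnFinite.symm fun p => if (p.2 : ℕ) < e g p.1 then 1 else 0

variable {e : G → V →₀ ℕ}

lemma lcmExp_polExp (f : List G) (p : Σ i, Fin (N i)) :
    lcmExp (polExp N e) f p = if (p.2 : ℕ) < lcmExp e f p.1 then 1 else 0 := by
  have h1 : lcmExp (polExp N e) f ≤ Finsupp.equivFunOnFinite.symm fun _ => 1 := by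
    refine lcmExp_le_iff.2 fun g _ p => ?_
    simp only [polExp, Finsupp.equivFunOnFinite_symm_apply_apply]
    split_ifs <;> lia
  have h2 : 0 < lcmExp (polExp N e) f p ↔ (p.2 : ℕ) < lcmExp e f p.1 := by
    rw [lt_lcmExp_iff, lt_lcmExp_iff]
    refine exists_congr fun g => and_congr_right fun _ => ?_
    simp only [polExp, Finsupp.equivFunOnFinite_symm_apply_apply]
    split_ifs with h <;> simp [h]
  have h3 : lcmExp (polExp N e) f p ≤ 1 := h1 p
  split_ifs with h
  · have := h2.2 h
    lia
  · have := mt h2.1 h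
    lia

lemma hitSet_polExp_eq {u : V →₀ ℕ} (hu : ∀ i, u i ≤ N i) {u' : (Σ i, Fin (N i)) →₀ ℕ}
    (h : ∀ p, u' p = if (p.2 : ℕ) + 1 = u p.1 then 1 else 0) :
    hitSet (polExp N e) u' = hitSet e u := by
  ext f
  constructor
  · intro hf i
    by_contra! hi
    have := hu i
    have := hf ⟨i, ⟨u i - 1, by lia⟩⟩
    rw [h, lcmExp_polExp, if_pos (by dsimp only; lia), if_neg (by dsimp only; lia)] at this
    lia
  · intro hf p
    have := hf p.1
    rw [h, lcmExp_polExp]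
    split_ifs <;> lia

lemma exists_hitSet_eq_hitSet_polExp {u' : (Σ i, Fin (N i)) →₀ ℕ} (h : ∀ p, u' p ≤ 1) :
    ∃ u : V →₀ ℕ, (∀ i t, t < u i ↔ ∃ j : Fin (N i), u' ⟨i, j⟩ ≠ 0 ∧ t < j + 1) ∧
      hitSet (polExp N e) u' = hitSet e u := by
  classical
  let u : V →₀ ℕ := Finsupp.equivFunOnFinite.symm fun i =>
    Finset.univ.sup fun j : Fin (N i) => if u' ⟨i, j⟩ ≠ 0 then (j : ℕ) + 1 else 0
  have hu : ∀ i t, t < u i ↔ ∃ j : Fin (N i), u' ⟨i, j⟩ ≠ 0 ∧ t < j + 1 := by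
    intro i t
    simp only [u, Finsupp.equivFunOnFinite_symm_apply_apply, Finset.lt_sup_iff, Finset.mem_univ,
      true_and]
    refine exists_congr fun j => ?_
    split_ifs with h <;> simp [h]
  refine ⟨u, hu, ?_⟩
  ext f
  constructor
  · intro hf i
    by_contra! hi
    obtain ⟨j, hj, hij⟩ := (hu i _).1 hi
    have := hf ⟨i, j⟩
    rw [lcmExp_polExp, if_neg (by dsimp only; lia)] at this
    lia
  · rintro hf ⟨i, j⟩
    by_cases h0 : u' ⟨i, j⟩ = 0
    · rw [h0]
      exact Nat.zero_le _
    · have h1 := (hu i j).2 ⟨j, h0, by lia⟩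
      have := hf i
      rw [lcmExp_polExp, if_pos (by dsimp only; lia)]
      exact h _

lemma exists_cocycleNZ_polExp_iff [∀ F : Finset (Σ i, Fin (N i)), DecidablePred (· ∉ F)]
    [∀ F : Finset V, DecidablePred (· ∉ F)]
    (he : ∀ g i, e g i ≤ N i) (p m s : ℕ)
    (hs : s + Fintype.card V = Fintype.card (Σ i, Fin (N i))) :
    (∃ F : Finset (Σ i, Fin (N i)), m ≤ F.card ∧ ∃ u, CocycleNZ k p
        (hitSet (polExp N e) u) (hitSet (polExp N e) (u.filter (· ∉ F)))) ↔
      ∃ F : Finset V, m ≤ F.card + s ∧ ∃ u, CocycleNZ k p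
        (hitSet e u) (hitSet e (u.filter (· ∉ F))) := by
  classical
  constructor
  · rintro ⟨F', hF', u', h⟩
    have hu' : ∀ p, u' p ≤ 1 := by
      intro p
      obtain ⟨l, hl⟩ := h.nonempty
      have := hl p
      rw [lcmExp_polExp] at this
      split_ifs at this <;> lia
    obtain ⟨u, hu, hu2⟩ := exists_hitSet_eq_hitSet_polExp (e := e) hu'
    obtain ⟨v, hv, hv2⟩ := exists_hitSet_eq_hitSet_polExp (e := e)
      (u' := u'.filter (· ∉ F')) (fun p => by
        rw [Finsupp.filter_apply]
        split_ifs
        · lia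
        · exact hu' p)
    rw [hu2, hv2] at h
    let F : Finset V := Finset.univ.filter fun i => ∀ j, (⟨i, j⟩ : Σ i, Fin (N i)) ∈ F'
    have hvu : ∀ i, v i ≤ u i := by
      intro i
      by_contra! hi
      obtain ⟨j, hj, hij⟩ := (hv i _).1 hi
      refine lt_irrefl _ ((hu i (u i)).2 ⟨j, fun h0 => hj ?_, hij⟩)
      rw [Finsupp.filter_apply, h0, ite_self]
    have hvF : ∀ i ∈ F, v i = 0 := by
      intro i hi
      by_contra h0
      obtain ⟨j, hj, -⟩ := (hv i 0).1 (by lia)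
      rw [Finsupp.filter_apply, if_neg] at hj
      · exact hj rfl
      · exact fun hj => hj ((Finset.mem_filter.1 hi).2 j)
    refine ⟨F, ?_, u.filter (· ∈ F) + v, ?_⟩
    · have h1 : Fᶜ.card ≤ F'ᶜ.card := by
        refine Finset.card_le_card_of_surjOn Sigma.fst fun i hi => ?_
        simpa [F] using hi
      have h2 := Finset.card_add_card_compl F
      have h3 := Finset.card_add_card_compl F'
      lia
    · have h1 : (u.filter (· ∈ F) + v).filter (· ∉ F) = v := by
        ext i
        rw [Finsupp.filter_apply]
        split_ifs with hi
        · exact (hvF i hi).symm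
        · simp [hi]
      rw [h1]
      refine h.mono (hitSet_anti fun i => ?_)
      rw [Finsupp.add_apply, Finsupp.filter_apply]
      split_ifs with hi
      · rw [hvF i hi]
        simp
      · simpa using hvu i
  · rintro ⟨F, hF, u, h⟩
    have hu : ∀ i, u i ≤ N i := by
      intro i
      obtain ⟨l, hl⟩ := h.nonempty
      refine (hl i).trans ?_
      have := lcmExp_le_iff (e := e) (f := l) (a := Finsupp.equivFunOnFinite.symm N) |>.2
        fun g _ i => he g i
      exact this i
    let u' : (Σ i, Fin (N i)) →₀ ℕ :=
      Finsupp.equivFunOnFinite.symm fun p => if (p.2 : ℕ) + 1 = u p.1 then 1 else 0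
    let F' : Finset (Σ i, Fin (N i)) :=
      Finset.univ.filter fun p => p.1 ∈ F ∨ (p.2 : ℕ) + 1 ≠ max (u p.1) 1
    refine ⟨F', ?_, u', ?_⟩
    · have h1 : F'ᶜ.card ≤ Fᶜ.card := by
        refine Finset.card_le_card_of_injOn Sigma.fst (fun p hp => ?_) fun p hp q hq hpq => ?_
        · simp [F'] at hp
          simp [hp]
        · obtain ⟨i, a⟩ := p
          obtain ⟨j, b⟩ := q
          obtain rfl : i = j := hpq
          simp only [F', Finset.coe_compl, Set.mem_compl_iff, Finset.mem_coe, Finset.mem_filter,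
            Finset.mem_univ, true_and, not_or, not_not] at hp hq
          congr 1
          exact Fin.ext (by lia)
      have h2 := Finset.card_add_card_compl F
      have h3 := Finset.card_add_card_compl F'
      lia
    · rw [hitSet_polExp_eq hu fun p => rfl, hitSet_polExp_eq (u := u.filter (· ∉ F))]
      · exact h
      · intro i
        rw [Finsupp.filter_apply]
        split_ifs
        · lia
        · exact hu i
      · intro p
        rw [Finsupp.filter_apply, Finsupp.filter_apply]
        simp only [u', F', Finset.mem_filter, Finset.mem_univ, true_and,
          Finsupp.equivFunOnFinite_symm_apply_apply]
        split_ifs <;> grind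

end Polarization

section Hitting

variable {σ G k : Type} [Field k] {U : σ → Set G}

/-- The lists which meet every set `U i` with `i ∈ A`. -/
def hitting (U : σ → Set G) (A : Finset σ) : Set (List G) := {l | ∀ i ∈ A, ∃ g ∈ l, g ∈ U i}

lemma hitting_mono {A : Finset σ} {l l' : List G} (h : l ⊆ l') (hl : l ∈ hitting U A) :
    l' ∈ hitting U A := fun i hi => (hl i hi).imp fun _ hg => ⟨h hg.1, hg.2⟩

lemma listCobdry_mem_hitting {A : Finset σ} {q : ℕ} {b : List G → k}
    (hb : ∀ l, l.length = q → b l ≠ 0 → l ∈ hitting U A) {l : List G} (hl : l.length = q + 1)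
    (h0 : listCobdry b l ≠ 0) : l ∈ hitting U A := by
  rw [listCobdry_eq_sum] at h0
  obtain ⟨l', hl', h1⟩ := Finset.exists_ne_zero_of_sum_ne_zero h0
  obtain ⟨h2, h3⟩ := mem_support_listBdry hl'
  exact hitting_mono h3 (hb l' (by lia) (right_ne_zero_of_mul h1))

open Classical in
lemma exists_eq_listCobdry_of_card_lt (A : Finset σ) (V : Set G) (p : ℕ) (hp : A.card < p)
    (c : List G → k) (hcA : ∀ l, l.length = p → c l ≠ 0 → l ∈ hitting U A)
    (hc : ∀ l : List G, l.length = p + 1 → (∀ g ∈ l, g ∈ V) → listCobdry c l = 0) :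
    ∃ b : List G → k, (∀ l, l.length + 1 = p → b l ≠ 0 → l ∈ hitting U A) ∧
      ∀ l : List G, l.length = p → (∀ g ∈ l, g ∈ V) → c l = listCobdry b l := by
  induction A using Finset.induction_on generalizing V p c with
  | empty =>
    rcases V.eq_empty_or_nonempty with rfl | ⟨g, hg⟩
    · refine ⟨0, by simp, fun l hl hlV => ?_⟩
      obtain rfl : l = [] := List.eq_nil_iff_forall_not_mem.2 hlV
      simp at hl
      lia
    · refine ⟨fun l => c (g :: l), fun l _ _ => by simp [hitting], fun l hl hlV => ?_⟩
      have := hc (g :: l) (by simp [hl]) (by simpa using ⟨hg, hlV⟩)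
      rwa [listCobdry_cons, sub_eq_zero] at this
  | insert i A hi ih =>
    rw [Finset.card_insert_of_notMem hi] at hp
    obtain ⟨q, rfl⟩ : ∃ q, p = q + 1 := ⟨p - 1, by lia⟩
    obtain ⟨b₁, hb₁A, hb₁⟩ := ih V (q + 1) (by lia) c
      (fun l hl h0 j hj => hcA l hl h0 j (Finset.mem_insert_of_mem hj)) hc
    obtain ⟨b₂, hb₂A, hb₂⟩ := ih (V \ U i) q (by lia) b₁ (fun l hl => hb₁A l (by lia))
      fun l hl hlV => by
        rw [← hb₁ l hl fun g hg => (hlV g hg).1]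
        by_contra h0
        obtain ⟨g, hg, hgi⟩ := hcA l hl h0 i (Finset.mem_insert_self i A)
        exact (hlV g hg).2 hgi
    refine ⟨fun l => if ∀ g ∈ l, g ∈ V then (b₁ - listCobdry b₂) l else 0, fun l hl h0 => ?_,
      fun l hl hlV => ?_⟩
    · obtain ⟨hlV, h0⟩ := ite_ne_right_iff.1 h0
      intro j hj
      rcases Finset.mem_insert.1 hj with rfl | hj
      · by_contra! hlj
        exact h0 (sub_eq_zero.2 (hb₂ l (by lia) fun g hg => ⟨hlV g hg, hlj g hg⟩))
      · by_cases h1 : b₁ l = 0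
        · obtain ⟨t, rfl⟩ : ∃ t, q = t + 1 := ⟨q - 1, by lia⟩
          refine listCobdry_mem_hitting (q := t) (b := b₂) (fun l hl => hb₂A l (by lia)) (by lia)
            (fun h2 => h0 ?_) j hj
          simp [h1, h2]
        · exact hb₁A l hl h1 j hj
    · rw [hb₁ l hl hlV, listCobdry_congr (c' := b₁ - listCobdry b₂)
        fun l' _ hl' => if_pos fun g hg => hlV g (hl' hg), listCobdry_sub,
        listCobdry_listCobdry, sub_zero]

open Classical in
lemma exists_cocycle_of_minimal (C : Finset σ) (V : Set G) (hV : ∀ g ∈ V, ∃ i ∈ C, g ∈ U i)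
    (hC : ∀ i ∈ C, ∃ g ∈ V, ∀ j ∈ C, g ∈ U j ↔ j = i) :
    ∃ c : List G → k, (∀ l, l.length = C.card → c l ≠ 0 → l ∈ hitting U C) ∧
      (∀ l : List G, l.length = C.card + 1 → (∀ g ∈ l, g ∈ V) → listCobdry c l = 0) ∧
      ¬ ∃ b : List G → k, (∀ l, l.length + 1 = C.card → b l ≠ 0 → l ∈ hitting U C) ∧
        ∀ l : List G, l.length = C.card → (∀ g ∈ l, g ∈ V) → c l = listCobdry b l := by
  induction C using Finset.induction_on generalizing V with
  | empty =>
    refine ⟨fun _ => 1, by simp [hitting], fun l hl hlV => ?_, ?_⟩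
    · cases l with
      | nil => simp
      | cons g l => simpa using hV g (hlV g (by simp))
    · rintro ⟨b, -, hb⟩
      simpa using hb [] rfl (by simp)
  | insert i C hi ih =>
    rw [Finset.card_insert_of_notMem hi]
    obtain ⟨c, hcC, hc, hcb⟩ := ih (V \ U i)
      (fun g hg => by
        obtain ⟨j, hj, hgj⟩ := hV g hg.1
        rcases Finset.mem_insert.1 hj with rfl | hj
        · exact (hg.2 hgj).elim
        · exact ⟨j, hj, hgj⟩)
      fun j hj => by
        obtain ⟨g, hg, hgj⟩ := hC j (Finset.mem_insert_of_mem hj)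
        refine ⟨g, ⟨hg, fun hgi => hi ?_⟩, fun t ht => hgj t (Finset.mem_insert_of_mem ht)⟩
        rwa [(hgj i (Finset.mem_insert_self i C)).1 hgi]
    refine ⟨fun l => if ∀ g ∈ l, g ∈ V then listCobdry c l else 0, fun l hl h0 => ?_,
      fun l hl hlV => ?_, ?_⟩
    · obtain ⟨hlV, h0⟩ := ite_ne_right_iff.1 h0
      intro j hj
      rcases Finset.mem_insert.1 hj with rfl | hj
      · by_contra! hlj
        exact h0 (hc l hl fun g hg => ⟨hlV g hg, hlj g hg⟩)
      · exact listCobdry_mem_hitting hcC hl h0 j hj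
    · rw [listCobdry_congr (c' := listCobdry c)
        fun l' _ hl' => if_pos fun g hg => hlV g (hl' hg), listCobdry_listCobdry]
    · rintro ⟨b, hbC, hb⟩
      obtain ⟨g, hg, hgi⟩ := hC i (Finset.mem_insert_self i C)
      refine hcb ⟨fun l => (c - b) (g :: l), fun l hl h0 j hj => ?_, fun l hl hlV => ?_⟩
      · have h1 : g :: l ∈ hitting U C := by
          by_cases h1 : c (g :: l) = 0
          · have h2 : b (g :: l) ≠ 0 := fun h2 => h0 (by simp [h1, h2])
            exact fun j hj => hbC _ (by simp [hl]) h2 j (Finset.mem_insert_of_mem hj)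
          · exact hcC _ (by simpa using hl) h1
        obtain ⟨x, hx, hxj⟩ := h1 j hj
        rcases List.mem_cons.1 hx with rfl | hx
        · exact (hi ((hgi j (Finset.mem_insert_of_mem hj)).1 hxj ▸ hj)).elim
        · exact ⟨x, hx, hxj⟩
      · have h1 : ∀ x ∈ g :: l, x ∈ V := by
          simpa using ⟨hg, fun x hx => (hlV x hx).1⟩
        have h2 := hb (g :: l) (by simp [hl]) h1
        beta_reduce at h2
        rw [if_pos h1, ← sub_eq_zero, ← listCobdry_sub, listCobdry_cons, sub_eq_zero] at h2
        rw [← h2, Pi.sub_apply, eq_comm, sub_eq_self]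
        by_contra h3
        obtain ⟨x, hx, hxi⟩ := hbC l (by lia) h3 i (Finset.mem_insert_self i C)
        exact (hlV x hx).2 hxi

variable {e : G → σ →₀ ℕ}

lemma hitSet_eq_hitting [Fintype σ] (u : σ →₀ ℕ) :
    hitSet e u = hitting (fun i => {g | u i ≤ e g i}) u.support := by
  ext f
  refine forall_congr' fun i => ?_
  by_cases h0 : u i = 0
  · simp [h0]
  · obtain ⟨t, ht⟩ : ∃ t, u i = t + 1 := ⟨u i - 1, by lia⟩
    simp [ht, lt_lcmExp_iff]

lemma CocycleNZ.le_card [Fintype σ] {u v : σ →₀ ℕ} (hvu : v ≤ u) {p : ℕ}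
    (h : CocycleNZ k p (hitSet e u) (hitSet e v)) : p ≤ Fintype.card σ := by
  by_contra! hp
  obtain ⟨c, hcu, hc, hb⟩ := h
  simp only [hitSet_eq_hitting u] at hcu
  obtain ⟨b, hbu, hb'⟩ := exists_eq_listCobdry_of_card_lt u.support Set.univ p
    ((Finset.card_le_univ _).trans_lt hp) c hcu fun l hl _ => hc l hl
  rw [← hitSet_eq_hitting] at hbu
  exact hb ⟨b, fun l hl h0 => hitSet_anti hvu (hbu l hl h0), fun l hl => hb' l hl (by simp)⟩

lemma exists_cocycleNZ [Fintype σ] [∀ F : Finset σ, DecidablePred (· ∉ F)] (k : Type) [Field k]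
    (he : ∀ g, e g ≠ 0) :
    ∃ p ≤ Fintype.card σ, ∃ F : Finset σ, Fintype.card σ ≤ p + F.card ∧
      ∃ u, CocycleNZ k p (hitSet e u) (hitSet e (u.filter (· ∉ F))) := by
  classical
  obtain ⟨C, -, hC⟩ := Finite.exists_le_minimal (p := fun C : Finset σ => ∀ g, ∃ i ∈ C, e g i ≠ 0)
    (a := Finset.univ) fun g => by simpa using Finsupp.ne_iff.1 (he g)
  let u : σ →₀ ℕ := Finsupp.equivFunOnFinite.symm fun i => if i ∈ C then 1 else 0
  have hu : ∀ i, u i = if i ∈ C then 1 else 0 := fun i => rfl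
  have huC : u.support = C := by
    ext i
    simp [hu]
  have huF : u.filter (· ∉ Cᶜ) = u := by
    ext i
    simp +contextual [Finsupp.filter_apply, hu]
  refine ⟨C.card, Finset.card_le_univ C, Cᶜ, by rw [Finset.card_add_card_compl], u, ?_⟩
  obtain ⟨c, hcC, hc, hb⟩ := exists_cocycle_of_minimal (k := k)
    (U := fun i => {g | u i ≤ e g i}) C Set.univ
    (fun g _ => by
      obtain ⟨i, hi, hgi⟩ := hC.prop g
      exact ⟨i, hi, by simpa [hu, hi, Nat.one_le_iff_ne_zero] using hgi⟩)
    fun i hi => by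
      have h1 := hC.not_prop_of_lt (Finset.erase_ssubset hi)
      push Not at h1
      obtain ⟨g, hg⟩ := h1
      refine ⟨g, trivial, fun j hj => ?_⟩
      simp only [hu, hj, if_true, Set.mem_ofPred_eq, Nat.one_le_iff_ne_zero]
      constructor
      · intro h2
        by_contra hji
        exact h2 (hg j (Finset.mem_erase.2 ⟨hji, hj⟩))
      · rintro rfl
        obtain ⟨t, ht, hgt⟩ := hC.prop g
        by_cases htj : t = j
        · rwa [← htj]
        · exact (hgt (hg t (Finset.mem_erase.2 ⟨htj, ht⟩))).elim
  rw [huF, hitSet_eq_hitting, huC]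
  exact ⟨c, hcC, fun l hl => hc l hl (by simp), fun ⟨b, h1, h2⟩ => hb ⟨b, h1, fun l hl _ => h2 l hl⟩⟩

end Hitting

section MinimalExponents

variable {V k : Type} [Field k] {I : Ideal (MvPolynomial V k)}

instance [Finite V] : Finite (minimalExps k I) := by
  refine Set.Finite.to_subtype ?_
  have h : IsAntichain (· ≤ ·) (minimalExps k I) := fun a ha b hb hab hle =>
    hab (hb.2 a ha.1 hle)
  have h2 := Set.isPWO_of_wellQuasiOrderedLE (minimalExps k I)
  exact h.finite_of_partiallyWellOrderedOn h2

lemma IsMonomialIdeal.eq_expIdeal (hI : IsMonomialIdeal k I) :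
    I = expIdeal (Subtype.val : minimalExps k I → V →₀ ℕ) k := by
  apply le_antisymm
  · obtain ⟨A, hA⟩ := hI
    rw [hA, Ideal.span_le]
    rintro _ ⟨a, ha, rfl⟩
    have haI : monomial a (1 : k) ∈ I := hA ▸ Ideal.subset_span ⟨a, ha, rfl⟩
    obtain ⟨b, hba, hb⟩ := exists_minimal_le_of_wellFoundedLT
      (fun b : V →₀ ℕ => monomial b (1 : k) ∈ I) a haI
    have hb' : b ∈ minimalExps k I :=
      ⟨hb.prop, fun t ht htb => le_antisymm htb (hb.le_of_le ht htb)⟩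
    have h : monomial a (1 : k) = monomial (a - b) 1 * monomial b 1 := by
      rw [monomial_mul, tsub_add_cancel_of_le hba, one_mul]
    beta_reduce
    rw [h]
    exact Ideal.mul_mem_left _ _ (Ideal.subset_span ⟨⟨b, hA ▸ hb'⟩, rfl⟩)
  · rw [expIdeal, Ideal.span_le]
    rintro _ ⟨g, rfl⟩
    exact g.2.1

lemma le_polGamma [Finite V] (g : minimalExps k I) (i : V) : g.1 i ≤ polGamma k I i := by
  refine le_csSup (Set.Finite.bddAbove ?_) ⟨g, g.2, rfl⟩
  refine (Set.finite_range fun g : minimalExps k I => g.1 i).subset ?_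
  rintro _ ⟨a, ha, rfl⟩
  exact ⟨⟨a, ha⟩, rfl⟩

lemma polIdeal_eq_expIdeal [Fintype V] [DecidableEq V] :
    polIdeal k I = expIdeal (polExp (fun i => max (polGamma k I i) 1)
      (Subtype.val : minimalExps k I → V →₀ ℕ)) k := by
  rw [polIdeal, expIdeal]
  congr 1
  ext m
  have h : ∀ g : minimalExps k I, (monomial (polExp (fun i => max (polGamma k I i) 1)
      Subtype.val g) (1 : k)) =
      ∏ p : polVars k I, if (p.2 : ℕ) < g.1 p.1 then X p else 1 := by
    intro g
    rw [monomial_eq, map_one, one_mul, Finsupp.prod_fintype _ _ (by simp)]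
    refine Finset.prod_congr rfl fun p _ => ?_
    simp only [polExp, Finsupp.equivFunOnFinite_symm_apply_apply]
    split_ifs <;> simp
  constructor
  · rintro ⟨a, ha, rfl⟩
    exact ⟨⟨a, ha⟩, h _⟩
  · rintro ⟨g, rfl⟩
    exact ⟨g, g.2, h _⟩

end MinimalExponents

section Shift

lemma sInf_add_of_forall_mem_iff {A B : Set ℕ} {s : ℕ} (h : ∀ j, j + s ∈ B ↔ j ∈ A)
    (hlt : ∀ j < s, j ∉ B) (hne : s = 0 ∨ A.Nonempty) : sInf B = sInf A + s := by
  rcases hne with rfl | hne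
  · rw [add_zero, show B = A from Set.ext h]
  refine IsLeast.csInf_eq ⟨(h _).2 (Nat.sInf_mem hne), fun j hj => ?_⟩
  by_contra! h1
  by_cases hjs : j < s
  · exact hlt j hjs hj
  · obtain ⟨t, rfl⟩ := Nat.exists_eq_add_of_le' (not_lt.1 hjs)
    have := Nat.sInf_le ((h t).1 hj)
    lia

end Shift

/-- Proposition `polarization`: for a monomial ideal `I` of
`S = k[x_1, …, x_n]` with `S/I` unmixed and `r ≥ 2`,
`S_r-depth(S^pol/I^pol) = S_r-depth(S/I) + |X_I|`, where `|X_I|` is the number of new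
variables introduced by the polarization (stated additively as
`S_r-depth(S^pol/I^pol) + n = S_r-depth(S/I) + (number of variables of S^pol)`). -/
theorem serreDepth_polarization
    (k : Type) [Field k] (n r : ℕ) (hr : 2 ≤ r)
    (I : Ideal (MvPolynomial (Fin n) k))
    (hmono : IsMonomialIdeal k I) (hunm : IsUnmixedIdeal I) :
    serreDepth k r (quotMod k (polIdeal k I)) + n =
      serreDepth k r (quotMod k I) + Nat.card (polVars k I) := by
  classical
  have hI := hmono.eq_expIdeal
  rw [polIdeal_eq_expIdeal]
  have hJ : quotMod k I = quotMod k (expIdeal (Subtype.val : minimalExps k I → _) k) :=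
    congrArg (quotMod k) hI
  rw [hJ]
  have he : ∀ (g : minimalExps k I) i, g.1 i ≤ max (polGamma k I i) 1 := fun g i =>
    (le_polGamma g i).trans (le_max_left _ _)
  have hn : n ≤ Fintype.card (polVars k I) := by
    rw [Fintype.card_sigma]
    simpa using Finset.card_nsmul_le_sum Finset.univ
      (fun i => Fintype.card (Fin (max (polGamma k I i) 1))) 1 fun i _ => by simp
  obtain ⟨s, hs⟩ := Nat.exists_eq_add_of_le' hn
  have hpol := exists_cocycleNZ_polExp_iff (k := k) he (s := s)
  simp only [serreDepth, serreK, le_modDim_extM_iff, Nat.card_eq_fintype_card, Fintype.card_fin]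
  rw [hs]
  refine (congrArg (· + n) (sInf_add_of_forall_mem_iff (s := s) (fun j => ?_) (fun j hj hm => ?_)
    ?_)).trans (add_assoc _ _ _)
  · simp only [Set.mem_ofPred_eq]
    rw [hpol _ _ (by simpa using hs.symm), show s + n - (j + s) = n - j by lia]
    exact exists_congr fun F => and_congr_left fun _ => by lia
  · obtain ⟨F, -, u, h⟩ := (hpol _ _ (by simpa using hs.symm)).1 hm
    have := h.le_card (fun i => by
      rw [Finsupp.filter_apply]; split_ifs <;> simp)
    rw [Fintype.card_fin] at this
    lia
  · by_cases hz : ∃ g : minimalExps k I, g.1 = 0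
    · obtain ⟨g, hg⟩ := hz
      left
      have hγ : ∀ i, polGamma k I i = 0 := fun i => Nat.le_zero.1 <| csSup_le' <| by
        rintro _ ⟨a, ha, rfl⟩
        rw [← ha.2 g.1 g.2.1 (hg ▸ zero_le), hg]
        simp
      rw [Fintype.card_sigma] at hs
      simp [hγ] at hs
      exact hs
    · push Not at hz
      right
      obtain ⟨p, hp, F, hF, u, h⟩ := exists_cocycleNZ (e := (Subtype.val : minimalExps k I → _)) k
        fun g => hz g
      rw [Fintype.card_fin] at hp hF
      refine ⟨n - p, F, by lia, u, ?_⟩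
      rwa [Nat.sub_sub_self hp]

end

end SerrePaper
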